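/- Let F be the centered Gaussian process with covariance E[F(s)F(t)] = (2π)^{-1/2}(√(t+s) − √|t−s|). For every partition Π = {0 = t_0 < t_1 < t_2 < …} of [0,∞) with t_j → ∞ and finite mesh |Π| = sup_j (t_j − t_{j−1}), define N(t) = max{j : t_j ≤ t} and V_Π(t) = ∑_{j=1}^{N(t)} |F(t_j) − F(t_{j−1})|⁴. Then for every T > 0 and every ε > 0 there exists δ > 0 such that every such partition Π with |Π| < δ satisfies E[ sup_{0 ≤ t ≤ T} |V_Π(t) − (6/π)t|² ] < ε. (The quartic variation of F equals (6/π)t, in the L² sense, uniformly on compacts.) -/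

import Mathlib

open MeasureTheory ProbabilityTheory Filter

/-- The covariance function `K(s,t) = (2π)^{-1/2}(√(t+s) − √|t−s|)`. -/
noncomputable def covK (s t : ℝ) : ℝ :=
  (Real.sqrt (2 * Real.pi))⁻¹ * (Real.sqrt (t + s) - Real.sqrt |t - s|)

/-- `F` is the centered Gaussian process with covariance `covK`, on a probability
space `(Ω, P)`: every finite linear combination of values of `F` at nonnegative
times is centered Gaussian with the prescribed variance. -/
def IsHeatGaussian {Ω : Type*} [MeasurableSpace Ω] (P : Measure Ω)
    (F : ℝ → Ω → ℝ) : Prop :=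
  IsProbabilityMeasure P ∧ (∀ t : ℝ, Measurable (F t)) ∧
  ∀ (m : ℕ) (ts : Fin m → ℝ) (c : Fin m → ℝ), (∀ i, 0 ≤ ts i) →
    Measure.map (fun ω => ∑ i, c i * F (ts i) ω) P =
      gaussianReal 0 (Real.toNNReal (∑ i, ∑ j, c i * c j * covK (ts i) (ts j)))

section GaussianMoments

lemma iteratedDeriv_exp_mul_sq_div_two (v : ℝ) (n : ℕ) (t : ℝ) :
    iteratedDeriv (n + 2) (fun s : ℝ => Real.exp (v * s ^ 2 / 2)) t =
      v * t * iteratedDeriv (n + 1) (fun s : ℝ => Real.exp (v * s ^ 2 / 2)) t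
        + v * (n + 1) * iteratedDeriv n (fun s : ℝ => Real.exp (v * s ^ 2 / 2)) t := by
  set f : ℝ → ℝ := fun s => Real.exp (v * s ^ 2 / 2) with hf
  have hc : ContDiff ℝ ⊤ f := by fun_prop
  have hd : ∀ k s, HasDerivAt (iteratedDeriv k f) (iteratedDeriv (k + 1) f s) s := by
    intro k s
    rw [iteratedDeriv_succ]
    exact ((hc.differentiable_iteratedDeriv k
      (WithTop.coe_lt_top _)) s).hasDerivAt
  have h1 : ∀ s, iteratedDeriv 1 f s = v * s * f s := by
    intro s
    rw [iteratedDeriv_one]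
    have h : HasDerivAt f (Real.exp (v * s ^ 2 / 2) * (v * (2 * s) / 2)) s := by
      have := ((((hasDerivAt_id s).pow 2).const_mul v).div_const 2).exp
      simpa using this
    rw [h.deriv]
    simp only [hf]
    ring
  induction n generalizing t with
  | zero =>
    have h : HasDerivAt (iteratedDeriv 1 f) (v * f t + v * t * iteratedDeriv 1 f t) t := by
      have := ((hasDerivAt_id t).const_mul v).mul
        (by simpa only [iteratedDeriv_zero] using hd 0 t : HasDerivAt f (iteratedDeriv 1 f t) t)
      have e : iteratedDeriv 1 f = (fun s => v * id s) * f := by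
        ext s; simp [h1 s]
      rw [e]
      simpa [h1 t] using this
    rw [(hd 1 t).unique h]
    simp
    ring
  | succ n ih =>
    have e : iteratedDeriv (n + 2) f = fun s => v * s * iteratedDeriv (n + 1) f s
        + v * (n + 1) * iteratedDeriv n f s := by
      ext s; exact ih s
    have h := (((hasDerivAt_id t).const_mul v).mul (hd (n + 1) t)).add
      ((hd n t).const_mul (v * (n + 1)))
    have h2 := hd (n + 2) t
    rw [e] at h2
    rw [show n + 1 + 2 = n + 2 + 1 by ring, h2.unique h]
    push_cast
    simp only [id]
    ring

lemma integral_pow_add_two_gaussianReal (w : NNReal) (n : ℕ) :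
    ∫ x, x ^ (n + 2) ∂(gaussianReal 0 w) = w * (n + 1) * ∫ x, x ^ n ∂(gaussianReal 0 w) := by
  have key : ∀ k : ℕ, ∫ x, x ^ k ∂(gaussianReal 0 w)
      = iteratedDeriv k (fun s : ℝ => Real.exp ((w : ℝ) * s ^ 2 / 2)) 0 := by
    intro k
    have h := iteratedDeriv_mgf_zero (X := id) (μ := gaussianReal 0 w) (by simp) k
    rw [mgf_id_gaussianReal] at h
    simpa using h.symm
  rw [key, key, iteratedDeriv_exp_mul_sq_div_two]
  ring

variable {Ω : Type*} [MeasurableSpace Ω] {P : Measure Ω}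

lemma integral_pow_of_map_eq_gaussianReal {Z : Ω → ℝ} {w : NNReal} (hm : Measurable Z)
    (h : P.map Z = gaussianReal 0 w) (n : ℕ) :
    ∫ ω, Z ω ^ n ∂P = ∫ x, x ^ n ∂(gaussianReal 0 w) := by
  rw [← h, integral_map hm.aemeasurable (by fun_prop)]

lemma integral_sq_of_map_eq_gaussianReal {Z : Ω → ℝ} {w : NNReal} (hm : Measurable Z)
    (h : P.map Z = gaussianReal 0 w) : ∫ ω, Z ω ^ 2 ∂P = w := by
  rw [integral_pow_of_map_eq_gaussianReal hm h]
  have := integral_pow_add_two_gaussianReal w 0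
  simpa using this

lemma integral_pow_four_of_map_eq_gaussianReal {Z : Ω → ℝ} {w : NNReal} (hm : Measurable Z)
    (h : P.map Z = gaussianReal 0 w) : ∫ ω, Z ω ^ 4 ∂P = 3 * (∫ ω, Z ω ^ 2 ∂P) ^ 2 := by
  rw [integral_sq_of_map_eq_gaussianReal hm h, integral_pow_of_map_eq_gaussianReal hm h,
    integral_pow_add_two_gaussianReal w 2, integral_pow_add_two_gaussianReal w 0]
  simp
  ring

lemma integral_pow_eight_of_map_eq_gaussianReal {Z : Ω → ℝ} {w : NNReal} (hm : Measurable Z)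
    (h : P.map Z = gaussianReal 0 w) : ∫ ω, Z ω ^ 8 ∂P = 105 * (∫ ω, Z ω ^ 2 ∂P) ^ 4 := by
  rw [integral_sq_of_map_eq_gaussianReal hm h, integral_pow_of_map_eq_gaussianReal hm h,
    integral_pow_add_two_gaussianReal w 6, integral_pow_add_two_gaussianReal w 4,
    integral_pow_add_two_gaussianReal w 2, integral_pow_add_two_gaussianReal w 0]
  simp
  ring

lemma integrable_pow_of_map_eq_gaussianReal {Z : Ω → ℝ} {w : NNReal} (hm : Measurable Z)
    (h : P.map Z = gaussianReal 0 w) (n : ℕ) : Integrable (fun ω => Z ω ^ n) P := by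
  have h1 : Integrable (fun x : ℝ => x ^ n) (gaussianReal 0 w) := by
    rcases Nat.eq_zero_or_pos n with rfl | hn
    · simp
    · have := (memLp_id_gaussianReal (μ := 0) (v := w) n).integrable_norm_pow hn.ne'
      exact this.mono' (by fun_prop) (by simp)
  rw [← h] at h1
  exact h1.comp_measurable hm

end GaussianMoments

section GaussianPairs

variable {Ω : Type*} [MeasurableSpace Ω] {P : Measure Ω}

/-- Every linear combination of `X` and `Y` is a centered real Gaussian. -/
def IsCenteredGaussianPair (P : Measure Ω) (X Y : Ω → ℝ) : Prop :=
  Measurable X ∧ Measurable Y ∧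
    ∀ a b : ℝ, ∃ w, P.map (fun ω => a * X ω + b * Y ω) = gaussianReal 0 w

namespace IsCenteredGaussianPair

variable {X Y : Ω → ℝ}

lemma symm (h : IsCenteredGaussianPair P X Y) : IsCenteredGaussianPair P Y X :=
  ⟨h.2.1, h.1, fun a b => by simpa [add_comm] using h.2.2 b a⟩

lemma exists_map_eq (h : IsCenteredGaussianPair P X Y) : ∃ w, P.map X = gaussianReal 0 w := by
  simpa using h.2.2 1 0

lemma integrable_pow (h : IsCenteredGaussianPair P X Y) (n : ℕ) :
    Integrable (fun ω => X ω ^ n) P := by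
  obtain ⟨w, hw⟩ := h.exists_map_eq
  exact integrable_pow_of_map_eq_gaussianReal h.1 hw n

lemma integrable_pow_mul_pow (h : IsCenteredGaussianPair P X Y) (m n : ℕ) :
    Integrable (fun ω => X ω ^ m * Y ω ^ n) P := by
  refine MemLp.integrable_mul (p := 2) (q := 2) ?_ ?_
  · rw [memLp_two_iff_integrable_sq (h.1.pow_const m).aestronglyMeasurable]
    simpa [← pow_mul] using h.integrable_pow (m * 2)
  · rw [memLp_two_iff_integrable_sq (h.2.1.pow_const n).aestronglyMeasurable]
    simpa [← pow_mul] using h.symm.integrable_pow (n * 2)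

lemma integrable_mul (h : IsCenteredGaussianPair P X Y) :
    Integrable (fun ω => X ω * Y ω) P := by
  simpa using h.integrable_pow_mul_pow 1 1

lemma measurable_comb (h : IsCenteredGaussianPair P X Y) (a b : ℝ) :
    Measurable (fun ω => a * X ω + b * Y ω) :=
  (h.1.const_mul a).add (h.2.1.const_mul b)

lemma integral_pow_four (h : IsCenteredGaussianPair P X Y) :
    ∫ ω, X ω ^ 4 ∂P = 3 * (∫ ω, X ω ^ 2 ∂P) ^ 2 := by
  obtain ⟨w, hw⟩ := h.exists_map_eq
  exact integral_pow_four_of_map_eq_gaussianReal h.1 hw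

lemma integral_comb_sq (h : IsCenteredGaussianPair P X Y) (a b : ℝ) :
    ∫ ω, (a * X ω + b * Y ω) ^ 2 ∂P = a ^ 2 * ∫ ω, X ω ^ 2 ∂P + 2 * a * b * ∫ ω, X ω * Y ω ∂P
      + b ^ 2 * ∫ ω, Y ω ^ 2 ∂P := by
  have e : (fun ω => (a * X ω + b * Y ω) ^ 2)
      = fun ω => a ^ 2 * X ω ^ 2 + 2 * a * b * (X ω * Y ω) + b ^ 2 * Y ω ^ 2 := by
    ext ω; ring
  have h1 := h.integrable_pow 2
  have h2 := h.symm.integrable_pow 2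
  have h3 := h.integrable_mul
  rw [e, integral_add (by fun_prop) (by fun_prop), integral_add (by fun_prop) (by fun_prop),
    integral_const_mul, integral_const_mul, integral_const_mul]

lemma integral_comb_pow_eight (h : IsCenteredGaussianPair P X Y) (a b : ℝ) :
    ∫ ω, (a * X ω + b * Y ω) ^ 8 ∂P =
      105 * (a ^ 2 * ∫ ω, X ω ^ 2 ∂P + 2 * a * b * ∫ ω, X ω * Y ω ∂P
      + b ^ 2 * ∫ ω, Y ω ^ 2 ∂P) ^ 4 := by
  obtain ⟨w, hw⟩ := h.2.2 a b
  rw [integral_pow_eight_of_map_eq_gaussianReal (h.measurable_comb a b) hw, h.integral_comb_sq]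

lemma sq_integral_mul_le (h : IsCenteredGaussianPair P X Y) :
    (∫ ω, X ω * Y ω ∂P) ^ 2 ≤ (∫ ω, X ω ^ 2 ∂P) * ∫ ω, Y ω ^ 2 ∂P := by
  have key : ∀ a b : ℝ, 0 ≤ a ^ 2 * ∫ ω, X ω ^ 2 ∂P + 2 * a * b * ∫ ω, X ω * Y ω ∂P
      + b ^ 2 * ∫ ω, Y ω ^ 2 ∂P := fun a b => by
    rw [← h.integral_comb_sq]
    exact integral_nonneg fun ω => sq_nonneg _
  have := discrim_le_zero (a := ∫ ω, X ω ^ 2 ∂P) (b := 2 * ∫ ω, X ω * Y ω ∂P)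
    (c := ∫ ω, Y ω ^ 2 ∂P) fun a => by have := key a 1; linarith
  rw [discrim] at this
  linarith

/-- Wick's formula for the mixed moment of order `(4, 4)`, by polarization of the eighth moment. -/
lemma integral_pow_four_mul_pow_four (h : IsCenteredGaussianPair P X Y) :
    ∫ ω, X ω ^ 4 * Y ω ^ 4 ∂P =
      9 * (∫ ω, X ω ^ 2 ∂P) ^ 2 * (∫ ω, Y ω ^ 2 ∂P) ^ 2
      + 72 * (∫ ω, X ω ^ 2 ∂P) * (∫ ω, Y ω ^ 2 ∂P) * (∫ ω, X ω * Y ω ∂P) ^ 2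
      + 24 * (∫ ω, X ω * Y ω ∂P) ^ 4 := by
  have e : (fun ω => X ω ^ 4 * Y ω ^ 4) = fun ω =>
      (3 / 40) * (1 * X ω + 0 * Y ω) ^ 8 + (3 / 40) * (0 * X ω + 1 * Y ω) ^ 8
      + (17 / 1260) * (1 * X ω + 1 * Y ω) ^ 8 + (17 / 1260) * (1 * X ω + (-1) * Y ω) ^ 8
      + (-1 / 5040) * (1 * X ω + 2 * Y ω) ^ 8 + (-1 / 5040) * (1 * X ω + (-2) * Y ω) ^ 8
      + (-1 / 5040) * (2 * X ω + 1 * Y ω) ^ 8 + (-1 / 5040) * (2 * X ω + (-1) * Y ω) ^ 8 := by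
    ext ω; ring
  have hi : ∀ a b : ℝ, Integrable (fun ω => (a * X ω + b * Y ω) ^ 8) P := fun a b => by
    obtain ⟨w, hw⟩ := h.2.2 a b
    exact integrable_pow_of_map_eq_gaussianReal (h.measurable_comb a b) hw 8
  have hj : ∀ c a b : ℝ, Integrable (fun ω => c * (a * X ω + b * Y ω) ^ 8) P :=
    fun c a b => (hi a b).const_mul c
  rw [e]
  iterate 7 rw [integral_add ?_ (hj _ _ _)]
  · simp only [integral_const_mul, h.integral_comb_pow_eight]
    ring
  all_goals
    repeat' first | exact hj _ _ _ | refine Integrable.add ?_ (hj _ _ _)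

end IsCenteredGaussianPair

lemma integral_sq_sum_pow_four_sub_le (hP : IsProbabilityMeasure P) (D : ℕ → Ω → ℝ)
    (hD : ∀ i j, IsCenteredGaussianPair P (D i) (D j)) (N : ℕ) :
    ∫ ω, (∑ j ∈ Finset.range N, (D j ω ^ 4 - 3 * (∫ ω, D j ω ^ 2 ∂P) ^ 2)) ^ 2 ∂P ≤
      ∑ i ∈ Finset.range N, ∑ j ∈ Finset.range N,
        96 * (∫ ω, D i ω ^ 2 ∂P) * (∫ ω, D j ω ^ 2 ∂P) * (∫ ω, D i ω * D j ω ∂P) ^ 2 := by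
  have hprod : ∀ i j, Integrable (fun ω => (D i ω ^ 4 - 3 * (∫ ω, D i ω ^ 2 ∂P) ^ 2)
      * (D j ω ^ 4 - 3 * (∫ ω, D j ω ^ 2 ∂P) ^ 2)) P ∧
      ∫ ω, (D i ω ^ 4 - 3 * (∫ ω, D i ω ^ 2 ∂P) ^ 2)
      * (D j ω ^ 4 - 3 * (∫ ω, D j ω ^ 2 ∂P) ^ 2) ∂P ≤
      96 * (∫ ω, D i ω ^ 2 ∂P) * (∫ ω, D j ω ^ 2 ∂P) * (∫ ω, D i ω * D j ω ∂P) ^ 2 := by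
    intro i j
    set p := ∫ ω, D i ω ^ 2 ∂P with hp
    set q := ∫ ω, D j ω ^ 2 ∂P with hq
    have e : (fun ω => (D i ω ^ 4 - 3 * p ^ 2) * (D j ω ^ 4 - 3 * q ^ 2)) = fun ω =>
        D i ω ^ 4 * D j ω ^ 4 + (-(3 * q ^ 2)) * D i ω ^ 4 + (-(3 * p ^ 2)) * D j ω ^ 4
          + 9 * p ^ 2 * q ^ 2 := by
      ext ω; ring
    have h1 := (hD i j).integrable_pow 4
    have h2 := (hD i j).symm.integrable_pow 4
    have h3 := (hD i j).integrable_pow_mul_pow 4 4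
    rw [e]
    refine ⟨by fun_prop, ?_⟩
    rw [integral_add (by fun_prop) (by fun_prop), integral_add (by fun_prop) (by fun_prop),
      integral_add (by fun_prop) (by fun_prop), integral_const_mul, integral_const_mul,
      (hD i j).integral_pow_four_mul_pow_four, (hD i j).integral_pow_four,
      (hD i j).symm.integral_pow_four, ← hp, ← hq]
    have h4 := (hD i j).sq_integral_mul_le
    rw [← hp, ← hq] at h4
    have h5 := mul_le_mul_of_nonneg_right h4 (sq_nonneg (∫ ω, D i ω * D j ω ∂P))
    simp only [integral_const, probReal_univ, one_smul]
    nlinarith [h5]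
  have e : (fun ω => (∑ j ∈ Finset.range N, (D j ω ^ 4 - 3 * (∫ ω, D j ω ^ 2 ∂P) ^ 2)) ^ 2) =
      fun ω => ∑ i ∈ Finset.range N, ∑ j ∈ Finset.range N,
        (D i ω ^ 4 - 3 * (∫ ω, D i ω ^ 2 ∂P) ^ 2)
          * (D j ω ^ 4 - 3 * (∫ ω, D j ω ^ 2 ∂P) ^ 2) := by
    ext ω
    rw [sq, Finset.sum_mul_sum]
  rw [e, integral_finsetSum _ fun i _ => integrable_finsetSum _ fun j _ => (hprod i j).1]
  refine Finset.sum_le_sum fun i _ => ?_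
  rw [integral_finsetSum _ fun j _ => (hprod i j).1]
  exact Finset.sum_le_sum fun j _ => (hprod i j).2

end GaussianPairs

section Covariance

lemma sqrt_sub_sqrt_le_sqrt_sub {x y : ℝ} (hx : 0 ≤ x) (hxy : x ≤ y) :
    √y - √x ≤ √(y - x) := by
  have h : √y ≤ √x + √(y - x) := by
    refine Real.sqrt_le_iff.2 ⟨by positivity, ?_⟩
    nlinarith [Real.sq_sqrt hx, Real.sq_sqrt (sub_nonneg.2 hxy),
      mul_nonneg (Real.sqrt_nonneg x) (Real.sqrt_nonneg (y - x))]
  linarith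

lemma sqrt_add_sub_sqrt_antitone {x y h : ℝ} (hx : 0 ≤ x) (hxy : x ≤ y) (hh : 0 ≤ h) :
    √(y + h) - √y ≤ √(x + h) - √x := by
  have h1 : √(y + h) * √x ≤ √(x + h) * √y := by
    rw [← Real.sqrt_mul (by linarith), ← Real.sqrt_mul (by linarith)]
    exact Real.sqrt_le_sqrt (by nlinarith)
  have h2 : √(y + h) + √x ≤ √(x + h) + √y := by
    refine le_of_sq_le_sq ?_ (by positivity)
    nlinarith [Real.sq_sqrt (show 0 ≤ y + h by linarith), Real.sq_sqrt hx,
      Real.sq_sqrt (show 0 ≤ x + h by linarith), Real.sq_sqrt (show 0 ≤ y by linarith)]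
  linarith

lemma inv_sqrt_two_pi_le_half : (√(2 * Real.pi))⁻¹ ≤ 1 / 2 := by
  rw [one_div]
  refine inv_anti₀ (by norm_num) (Real.le_sqrt_of_sq_le ?_)
  linarith [Real.pi_gt_three]

lemma covK_comm (s t : ℝ) : covK s t = covK t s := by
  simp only [covK, add_comm s t, abs_sub_comm s t]

lemma covK_of_le {s t : ℝ} (h : s ≤ t) :
    covK s t = (√(2 * Real.pi))⁻¹ * (√(t + s) - √(t - s)) := by
  rw [covK, abs_of_nonneg (sub_nonneg.2 h)]

lemma covK_nonneg {s t : ℝ} (hs : 0 ≤ s) (ht : 0 ≤ t) : 0 ≤ covK s t := by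
  refine mul_nonneg (by positivity) (sub_nonneg.2 (Real.sqrt_le_sqrt ?_))
  rw [abs_le]
  constructor <;> linarith

lemma covK_zero_right (s : ℝ) (hs : 0 ≤ s) : covK s 0 = 0 := by
  rw [covK_comm, covK_of_le hs]
  simp

/-- The covariance of the increments of the process over `[a, b]` and `[c, d]`. -/
noncomputable def incrCov (a b c d : ℝ) : ℝ :=
  covK b d - covK b c - covK a d + covK a c

lemma incrCov_comm (a b c d : ℝ) : incrCov a b c d = incrCov c d a b := by
  simp only [incrCov, covK_comm c, covK_comm d]
  ring

lemma incrCov_nonpos {a b c d : ℝ} (ha : 0 ≤ a) (hab : a ≤ b) (hbc : b ≤ c) (hcd : c ≤ d) :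
    incrCov a b c d ≤ 0 := by
  have h1 := sqrt_add_sub_sqrt_antitone (x := c + a) (y := c + b) (h := d - c)
    (by linarith) (by linarith) (by linarith)
  have h2 := sqrt_add_sub_sqrt_antitone (x := c - b) (y := c - a) (h := d - c)
    (by linarith) (by linarith) (by linarith)
  rw [show c + b + (d - c) = d + b by ring, show c + a + (d - c) = d + a by ring] at h1
  rw [show c - a + (d - c) = d - a by ring, show c - b + (d - c) = d - b by ring] at h2
  rw [incrCov, covK_of_le (hbc.trans hcd), covK_of_le hbc, covK_of_le (by linarith : a ≤ d),
    covK_of_le (hab.trans hbc), ← mul_sub, ← mul_sub, ← mul_add]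
  refine mul_nonpos_of_nonneg_of_nonpos (by positivity) ?_
  linarith

/-- The deviation of the variance of an increment from that of the stationary model. -/
lemma incrCov_self {a b : ℝ} (hab : a ≤ b) :
    incrCov a b a b = (√(2 * Real.pi))⁻¹ * (2 * √(b - a))
      - (√(2 * Real.pi))⁻¹ * (2 * √(b + a) - √(2 * a) - √(2 * b)) := by
  rw [incrCov, covK_comm b a, covK_of_le hab, covK_of_le le_rfl, covK_of_le le_rfl,
    sub_self, sub_self, Real.sqrt_zero, ← two_mul, ← two_mul]
  ring

lemma abs_covK_sub_le {a b t : ℝ} (ha : 0 ≤ a) (hab : a ≤ b) (hbt : b ≤ t) :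
    |covK b t - covK a t| ≤ √(b - a) := by
  have h1 := sqrt_sub_sqrt_le_sqrt_sub (x := t + a) (y := t + b) (by linarith) (by linarith)
  have h2 := sqrt_sub_sqrt_le_sqrt_sub (x := t - b) (y := t - a) (by linarith) (by linarith)
  have h3 := Real.sqrt_le_sqrt (show t + a ≤ t + b by linarith)
  have h4 := Real.sqrt_le_sqrt (show t - b ≤ t - a by linarith)
  rw [show t + b - (t + a) = b - a by ring] at h1
  rw [show t - a - (t - b) = b - a by ring] at h2
  have h5 : |√(t + b) - √(t - b) - (√(t + a) - √(t - a))| ≤ 2 * √(b - a) := by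
    rw [abs_le]; constructor <;> linarith
  rw [covK_of_le hbt, covK_of_le (hab.trans hbt), ← mul_sub, abs_mul,
    abs_of_nonneg (by positivity : 0 ≤ (√(2 * Real.pi))⁻¹)]
  calc _ ≤ 1 / 2 * (2 * √(b - a)) :=
        mul_le_mul inv_sqrt_two_pi_le_half h5 (abs_nonneg _) (by norm_num)
    _ = _ := by ring

lemma variance_defect_nonneg {a b : ℝ} (ha : 0 ≤ a) (hab : a ≤ b) :
    0 ≤ 2 * √(b + a) - √(2 * a) - √(2 * b) := by
  have h := sqrt_add_sub_sqrt_antitone (x := 2 * a) (y := b + a) (h := b - a)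
    (by linarith) (by linarith) (by linarith)
  rw [show b + a + (b - a) = 2 * b by ring, show 2 * a + (b - a) = b + a by ring] at h
  linarith

lemma variance_defect_le {a b : ℝ} (hab : a ≤ b) :
    2 * √(b + a) - √(2 * a) - √(2 * b) ≤ 2 * (√b - √a) := by
  have h := Real.sqrt_le_sqrt (show b + a ≤ 2 * b by linarith)
  rw [Real.sqrt_mul (by norm_num)] at h
  rw [Real.sqrt_mul (by norm_num), Real.sqrt_mul (by norm_num)]
  have h2 : √2 ≤ 2 := Real.sqrt_le_iff.2 (by norm_num)
  nlinarith [Real.sqrt_le_sqrt hab]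

lemma incrCov_self_le {a b : ℝ} (ha : 0 ≤ a) (hab : a ≤ b) : incrCov a b a b ≤ √(b - a) := by
  rw [incrCov_self hab]
  have h1 := mul_nonneg (by positivity : 0 ≤ (√(2 * Real.pi))⁻¹) (variance_defect_nonneg ha hab)
  have h2 := mul_le_mul_of_nonneg_right inv_sqrt_two_pi_le_half (Real.sqrt_nonneg (b - a))
  linarith

lemma abs_three_mul_incrCov_self_sq_sub_le {a b : ℝ} (ha : 0 ≤ a) (hab : a ≤ b)
    (h0 : 0 ≤ incrCov a b a b) :
    |3 * incrCov a b a b ^ 2 - 6 / Real.pi * (b - a)| ≤ 6 * √(b - a) * (√b - √a) := by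
  set κ := (√(2 * Real.pi))⁻¹ with hκ
  have hκ0 : 0 ≤ κ := by positivity
  have hκ1 : κ ≤ 1 / 2 := inv_sqrt_two_pi_le_half
  set r := 2 * √(b + a) - √(2 * a) - √(2 * b) with hr
  have hr0 : 0 ≤ r := variance_defect_nonneg ha hab
  have hr1 : r ≤ 2 * (√b - √a) := variance_defect_le hab
  set q := √(b - a) with hq
  have hq0 : 0 ≤ q := Real.sqrt_nonneg _
  have hqq : q ^ 2 = b - a := Real.sq_sqrt (sub_nonneg.2 hab)
  have e : 6 / Real.pi * (b - a) = 3 * (κ * (2 * q)) ^ 2 := by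
    rw [mul_pow, mul_pow, hqq, hκ, inv_pow, Real.sq_sqrt (by positivity)]
    field_simp
    ring
  have hs : incrCov a b a b = κ * (2 * q) - κ * r := incrCov_self hab
  have hab' := Real.sqrt_le_sqrt hab
  have k1 : κ * r ≤ √b - √a := by nlinarith
  have k0 : 0 ≤ κ * r := by positivity
  have k2 : κ * (2 * q) ≤ q := by nlinarith
  rw [e]
  set m := κ * (2 * q)
  set d := κ * r
  have k3 : |3 * incrCov a b a b ^ 2 - 3 * m ^ 2| = 3 * (d * (2 * m - d)) := by
    rw [hs, abs_of_nonpos (by nlinarith)]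
    ring
  rw [k3]
  have k4 : d * (2 * m - d) ≤ (√b - √a) * (2 * q) := by
    refine mul_le_mul k1 (by linarith) (by linarith) (by linarith)
  linarith

end Covariance

section HeatGaussian

variable {Ω : Type*} [MeasurableSpace Ω] {P : Measure Ω} {F : ℝ → Ω → ℝ}

lemma IsHeatGaussian.isCenteredGaussianPair_incr (hF : IsHeatGaussian P F) {a b c d : ℝ}
    (ha : 0 ≤ a) (hb : 0 ≤ b) (hc : 0 ≤ c) (hd : 0 ≤ d) :
    IsCenteredGaussianPair P (fun ω => F b ω - F a ω) (fun ω => F d ω - F c ω) := by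
  refine ⟨(hF.2.1 b).sub (hF.2.1 a), (hF.2.1 d).sub (hF.2.1 c), fun x y => ?_⟩
  refine ⟨_, Eq.trans ?_
    (hF.2.2 4 ![b, a, d, c] ![x, -x, y, -y] (by simp [Fin.forall_fin_succ, *]))⟩
  congr 1
  ext ω
  simp [Fin.sum_univ_four]
  ring

lemma IsHeatGaussian.isCenteredGaussianPair (hF : IsHeatGaussian P F) {s t : ℝ}
    (hs : 0 ≤ s) (ht : 0 ≤ t) : IsCenteredGaussianPair P (F s) (F t) := by
  refine ⟨hF.2.1 s, hF.2.1 t, fun x y => ?_⟩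
  refine ⟨_, Eq.trans ?_ (hF.2.2 2 ![s, t] ![x, y] (by simp [Fin.forall_fin_succ, *]))⟩
  simp [Fin.sum_univ_two]

lemma IsHeatGaussian.integral_mul (hF : IsHeatGaussian P F) {s t : ℝ}
    (hs : 0 ≤ s) (ht : 0 ≤ t) : ∫ ω, F s ω * F t ω ∂P = covK s t := by
  have hsq : ∀ r, 0 ≤ r → ∫ ω, F r ω ^ 2 ∂P = covK r r := fun r hr => by
    have h := hF.2.2 1 ![r] ![1] (by simp [hr])
    simp only [Fin.sum_univ_one] at h
    simp at h
    rw [integral_sq_of_map_eq_gaussianReal (hF.2.1 r) h,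
      Real.coe_toNNReal _ (covK_nonneg hr hr)]
  have hp := hF.isCenteredGaussianPair hs ht
  have h := hF.2.2 2 ![s, t] ![1, 1] (by simp [Fin.forall_fin_succ, *])
  simp only [Fin.sum_univ_two] at h
  simp only [Matrix.cons_val_zero, Matrix.cons_val_one] at h
  have h1 := integral_sq_of_map_eq_gaussianReal (hp.measurable_comb 1 1) h
  have := covK_nonneg hs hs
  have := covK_nonneg hs ht
  have := covK_nonneg ht hs
  have := covK_nonneg ht ht
  rw [Real.coe_toNNReal _ (by linarith), hp.integral_comb_sq, hsq s hs, hsq t ht,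
    covK_comm t s] at h1
  linarith

lemma IsHeatGaussian.integral_incr_mul (hF : IsHeatGaussian P F) {a b c d : ℝ}
    (ha : 0 ≤ a) (hb : 0 ≤ b) (hc : 0 ≤ c) (hd : 0 ≤ d) :
    ∫ ω, (F b ω - F a ω) * (F d ω - F c ω) ∂P = incrCov a b c d := by
  have e : (fun ω => (F b ω - F a ω) * (F d ω - F c ω)) = fun ω =>
      F b ω * F d ω - F b ω * F c ω - F a ω * F d ω + F a ω * F c ω := by
    ext ω; ring
  have h1 := (hF.isCenteredGaussianPair hb hd).integrable_mul
  have h2 := (hF.isCenteredGaussianPair hb hc).integrable_mul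
  have h3 := (hF.isCenteredGaussianPair ha hd).integrable_mul
  have h4 := (hF.isCenteredGaussianPair ha hc).integrable_mul
  rw [e, integral_add (by fun_prop) h4, integral_sub (by fun_prop) h3,
    integral_sub h1 h2, hF.integral_mul hb hd, hF.integral_mul hb hc, hF.integral_mul ha hd,
    hF.integral_mul ha hc, incrCov]

lemma IsHeatGaussian.integral_incr_sq (hF : IsHeatGaussian P F) {a b : ℝ}
    (ha : 0 ≤ a) (hb : 0 ≤ b) :
    ∫ ω, (F b ω - F a ω) ^ 2 ∂P = incrCov a b a b := by
  simp only [sq]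
  exact hF.integral_incr_mul ha hb ha hb

end HeatGaussian

section Partition

lemma sum_incrCov (t : ℕ → ℝ) (h0 : t 0 = 0) {a b : ℝ} (ha : 0 ≤ a) (hb : 0 ≤ b) (N : ℕ) :
    ∑ j ∈ Finset.range N, incrCov a b (t j) (t (j + 1)) = covK b (t N) - covK a (t N) := by
  have h := Finset.sum_range_sub (fun j => covK b (t j) - covK a (t j)) N
  simp only [h0, covK_zero_right a ha, covK_zero_right b hb, sub_zero] at h
  rw [← h]
  refine Finset.sum_congr rfl fun j _ => ?_
  rw [incrCov]
  ring

lemma sum_abs_incrCov_le {t : ℕ → ℝ} (h0 : t 0 = 0) (ht : Monotone t) {i N : ℕ} (hi : i < N)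
    (hnn : 0 ≤ incrCov (t i) (t (i + 1)) (t i) (t (i + 1))) :
    ∑ j ∈ Finset.range N, |incrCov (t i) (t (i + 1)) (t j) (t (j + 1))|
      ≤ 3 * √(t (i + 1) - t i) := by
  have hp : ∀ k, 0 ≤ t k := fun k => h0 ▸ ht (Nat.zero_le k)
  have e : ∀ j, |incrCov (t i) (t (i + 1)) (t j) (t (j + 1))| =
      -incrCov (t i) (t (i + 1)) (t j) (t (j + 1))
        + if j = i then 2 * incrCov (t i) (t (i + 1)) (t i) (t (i + 1)) else 0 := by
    intro j
    rcases lt_trichotomy j i with h | h | h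
    · rw [if_neg h.ne, abs_of_nonpos, add_zero]
      rw [incrCov_comm]
      exact incrCov_nonpos (hp j) (ht j.le_succ) (ht h) (ht i.le_succ)
    · rw [if_pos h, h, abs_of_nonneg hnn]
      ring
    · rw [if_neg h.ne', abs_of_nonpos, add_zero]
      exact incrCov_nonpos (hp i) (ht i.le_succ) (ht h) (ht j.le_succ)
  rw [Finset.sum_congr rfl fun j _ => e j, Finset.sum_add_distrib, Finset.sum_neg_distrib,
    Finset.sum_ite_eq' _ i, if_pos (Finset.mem_range.2 hi), sum_incrCov t h0 (hp i) (hp _)]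
  have h1 := abs_le.1 (abs_covK_sub_le (hp i) (ht i.le_succ) (ht (Nat.succ_le_of_lt hi)))
  have h2 := incrCov_self_le (hp i) (ht i.le_succ)
  linarith [h1.1]

variable {Ω : Type*} [MeasurableSpace Ω] {P : Measure Ω} {F : ℝ → Ω → ℝ}

lemma IsHeatGaussian.incrCov_self_nonneg (hF : IsHeatGaussian P F) {a b : ℝ}
    (ha : 0 ≤ a) (hb : 0 ≤ b) : 0 ≤ incrCov a b a b := by
  rw [← hF.integral_incr_sq ha hb]
  exact integral_nonneg fun ω => sq_nonneg _

lemma IsHeatGaussian.sq_incrCov_le (hF : IsHeatGaussian P F) {a b c d : ℝ}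
    (ha : 0 ≤ a) (hb : 0 ≤ b) (hc : 0 ≤ c) (hd : 0 ≤ d) :
    incrCov a b c d ^ 2 ≤ incrCov a b a b * incrCov c d c d := by
  have := (hF.isCenteredGaussianPair_incr ha hb hc hd).sq_integral_mul_le
  rwa [hF.integral_incr_mul ha hb hc hd, hF.integral_incr_sq ha hb,
    hF.integral_incr_sq hc hd] at this

lemma IsHeatGaussian.integral_sq_centered_quartic_sum_le (hF : IsHeatGaussian P F)
    {t : ℕ → ℝ} (h0 : t 0 = 0) (ht : Monotone t) {δ T : ℝ} (hδ : 0 ≤ δ)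
    (hmesh : ∀ j, t (j + 1) - t j ≤ δ) {N : ℕ} (hN : t N ≤ T) :
    ∫ ω, (∑ j ∈ Finset.range N, ((F (t (j + 1)) ω - F (t j) ω) ^ 4
        - 3 * incrCov (t j) (t (j + 1)) (t j) (t (j + 1)) ^ 2)) ^ 2 ∂P ≤ 288 * δ * T := by
  have hp : ∀ k, 0 ≤ t k := fun k => h0 ▸ ht (Nat.zero_le k)
  have h := integral_sq_sum_pow_four_sub_le hF.1 (fun j ω => F (t (j + 1)) ω - F (t j) ω)
    (fun i j => hF.isCenteredGaussianPair_incr (hp _) (hp _) (hp _) (hp _)) N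
  simp only [fun j => hF.integral_incr_sq (hp j) (hp (j + 1)),
    fun i j => hF.integral_incr_mul (hp i) (hp (i + 1)) (hp j) (hp (j + 1))] at h
  refine h.trans ?_
  set g : ℕ → ℕ → ℝ := fun i j => incrCov (t i) (t (i + 1)) (t j) (t (j + 1)) with hg
  have hs0 : ∀ i, 0 ≤ g i i := fun i => hF.incrCov_self_nonneg (hp _) (hp _)
  have hs1 : ∀ i, g i i ≤ √(t (i + 1) - t i) := fun i => incrCov_self_le (hp i) (ht i.le_succ)
  have hs2 : ∀ i, g i i ≤ √δ := fun i => (hs1 i).trans (Real.sqrt_le_sqrt (hmesh i))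
  have hδ2 : √δ * √δ = δ := Real.mul_self_sqrt hδ
  have hoff : ∀ i j, |g i j| ≤ √δ := fun i j => by
    refine abs_le_of_sq_le_sq ?_ (Real.sqrt_nonneg _)
    rw [sq √δ]
    exact (hF.sq_incrCov_le (hp _) (hp _) (hp _) (hp _)).trans
      (mul_le_mul (hs2 i) (hs2 j) (hs0 j) (Real.sqrt_nonneg _))
  have hrow : ∀ i ∈ Finset.range N, ∑ j ∈ Finset.range N, 96 * g i i * g j j * g i j ^ 2
      ≤ 288 * δ * (t (i + 1) - t i) := by
    intro i hi
    have hsum := sum_abs_incrCov_le h0 ht (Finset.mem_range.1 hi) (hs0 i)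
    have hsq : √(t (i + 1) - t i) * √(t (i + 1) - t i) = t (i + 1) - t i :=
      Real.mul_self_sqrt (sub_nonneg.2 (ht i.le_succ))
    calc ∑ j ∈ Finset.range N, 96 * g i i * g j j * g i j ^ 2
        ≤ ∑ j ∈ Finset.range N, 96 * g i i * δ * |g i j| := by
          refine Finset.sum_le_sum fun j _ => ?_
          have h1 : g j j * |g i j| ≤ δ :=
            hδ2 ▸ mul_le_mul (hs2 j) (hoff i j) (abs_nonneg _) (Real.sqrt_nonneg _)
          have h2 : 0 ≤ 96 * g i i * |g i j| := by have := hs0 i; positivity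
          rw [← sq_abs (g i j)]
          calc _ = 96 * g i i * |g i j| * (g j j * |g i j|) := by ring
            _ ≤ 96 * g i i * |g i j| * δ := mul_le_mul_of_nonneg_left h1 h2
            _ = _ := by ring
      _ = 96 * δ * (g i i * ∑ j ∈ Finset.range N, |g i j|) := by
          rw [← Finset.mul_sum]; ring
      _ ≤ 96 * δ * (√(t (i + 1) - t i) * (3 * √(t (i + 1) - t i))) := by
          refine mul_le_mul_of_nonneg_left (mul_le_mul (hs1 i) hsum ?_ ?_) (by positivity)
          · exact Finset.sum_nonneg fun _ _ => abs_nonneg _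
          · positivity
      _ = 288 * δ * (t (i + 1) - t i) := by
          rw [show ∀ x : ℝ, 96 * δ * (x * (3 * x)) = 288 * δ * (x * x) by intro x; ring, hsq]
  refine (Finset.sum_le_sum hrow).trans ?_
  rw [← Finset.mul_sum, Finset.sum_range_sub, h0, sub_zero]
  exact mul_le_mul_of_nonneg_left hN (by positivity)

lemma IsHeatGaussian.abs_sum_variance_sub_le (hF : IsHeatGaussian P F)
    {t : ℕ → ℝ} (h0 : t 0 = 0) (ht : Monotone t) {δ T : ℝ}
    (hmesh : ∀ j, t (j + 1) - t j ≤ δ) {N : ℕ} (hN : t N ≤ T) :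
    |∑ j ∈ Finset.range N, 3 * incrCov (t j) (t (j + 1)) (t j) (t (j + 1)) ^ 2
      - 6 / Real.pi * t N| ≤ 6 * √δ * √T := by
  have hp : ∀ k, 0 ≤ t k := fun k => h0 ▸ ht (Nat.zero_le k)
  have e : 6 / Real.pi * t N = ∑ j ∈ Finset.range N, 6 / Real.pi * (t (j + 1) - t j) := by
    rw [← Finset.mul_sum, Finset.sum_range_sub, h0, sub_zero]
  rw [e, ← Finset.sum_sub_distrib]
  calc _ ≤ ∑ j ∈ Finset.range N, 6 * √δ * (√(t (j + 1)) - √(t j)) := by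
        refine (Finset.abs_sum_le_sum_abs _ _).trans (Finset.sum_le_sum fun j _ => ?_)
        refine (abs_three_mul_incrCov_self_sq_sub_le (hp j) (ht j.le_succ)
          (hF.incrCov_self_nonneg (hp _) (hp _))).trans ?_
        have := Real.sqrt_le_sqrt (hmesh j)
        have := Real.sqrt_le_sqrt (ht j.le_succ)
        exact mul_le_mul_of_nonneg_right (by linarith) (by simpa using this)
    _ = 6 * √δ * √(t N) := by
        rw [← Finset.mul_sum, Finset.sum_range_sub (fun j => √(t j)), h0, Real.sqrt_zero, sub_zero]
    _ ≤ _ := mul_le_mul_of_nonneg_left (Real.sqrt_le_sqrt hN) (by positivity)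

lemma IsHeatGaussian.memLp_incr_pow_four (hF : IsHeatGaussian P F) {a b : ℝ}
    (ha : 0 ≤ a) (hb : 0 ≤ b) : MemLp (fun ω => (F b ω - F a ω) ^ 4) 2 P := by
  have h := hF.isCenteredGaussianPair_incr ha hb ha hb
  rw [memLp_two_iff_integrable_sq (h.1.pow_const 4).aestronglyMeasurable]
  simpa only [← pow_mul] using h.integrable_pow (4 * 2)

lemma IsHeatGaussian.integrable_sq_quartic_sum_sub (hF : IsHeatGaussian P F)
    {t : ℕ → ℝ} (hp : ∀ k, 0 ≤ t k) (N : ℕ) (x : ℕ → ℝ) (y : ℝ) :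
    Integrable (fun ω => (∑ j ∈ Finset.range N,
      ((F (t (j + 1)) ω - F (t j) ω) ^ 4 - x j) - y) ^ 2) P := by
  have := hF.1
  refine MemLp.integrable_sq (MemLp.sub (memLp_finsetSum _ fun j _ => ?_) (memLp_const y))
  exact (hF.memLp_incr_pow_four (hp _) (hp _)).sub (memLp_const (x j))

lemma IsHeatGaussian.integral_sq_quartic_sum_sub_le (hF : IsHeatGaussian P F)
    {t : ℕ → ℝ} (h0 : t 0 = 0) (ht : Monotone t) {δ T : ℝ} (hδ : 0 ≤ δ) (hδ1 : δ ≤ 1)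
    (hmesh : ∀ j, t (j + 1) - t j ≤ δ) {N : ℕ} {s : ℝ} (hN : t N ≤ s) (hs : s ≤ t N + δ)
    (hT : s ≤ T) :
    ∫ ω, (∑ j ∈ Finset.range N, (F (t (j + 1)) ω - F (t j) ω) ^ 4
      - 6 / Real.pi * s) ^ 2 ∂P ≤ (720 * T + 16) * δ := by
  have := hF.1
  have hp : ∀ k, 0 ≤ t k := fun k => h0 ▸ ht (Nat.zero_le k)
  set v : ℕ → ℝ := fun j => 3 * incrCov (t j) (t (j + 1)) (t j) (t (j + 1)) ^ 2 with hv
  set r := ∑ j ∈ Finset.range N, v j - 6 / Real.pi * s with hr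
  have hT0 : 0 ≤ T := (hp N).trans (hN.trans hT)
  have hc : 6 / Real.pi ≤ 2 := by
    rw [div_le_iff₀ Real.pi_pos]; linarith [Real.pi_gt_three]
  have hc0 : 0 ≤ 6 / Real.pi := by positivity
  have hr1 : |r| ≤ 6 * √δ * √T + 2 * δ := by
    have h1 := hF.abs_sum_variance_sub_le h0 ht hmesh (hN.trans hT)
    have h2 : |6 / Real.pi * t N - 6 / Real.pi * s| ≤ 2 * δ := by
      rw [← mul_sub, abs_mul, abs_of_nonneg hc0]
      refine mul_le_mul hc ?_ (abs_nonneg _) (by norm_num)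
      rw [abs_le]; constructor <;> linarith
    calc |r| = |(∑ j ∈ Finset.range N, v j - 6 / Real.pi * t N)
            + (6 / Real.pi * t N - 6 / Real.pi * s)| := by rw [hr]; congr 1; ring
      _ ≤ _ := (abs_add_le _ _).trans (add_le_add h1 h2)
  have hr2 : r ^ 2 ≤ 72 * δ * T + 8 * δ := by
    have h1 : r ^ 2 ≤ (6 * √δ * √T + 2 * δ) ^ 2 := sq_le_sq' (by linarith [neg_le_of_abs_le hr1])
      (le_of_abs_le hr1)
    have h2 : (6 * √δ * √T) ^ 2 = 36 * δ * T := by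
      rw [mul_pow, mul_pow, Real.sq_sqrt hδ, Real.sq_sqrt hT0]; norm_num
    nlinarith [sq_nonneg (6 * √δ * √T - 2 * δ)]
  have hU := hF.integral_sq_centered_quartic_sum_le h0 ht hδ hmesh (hN.trans hT)
  have hI := hF.integrable_sq_quartic_sum_sub hp N v 0
  simp only [sub_zero] at hI
  calc _ ≤ ∫ ω, (2 * (∑ j ∈ Finset.range N, ((F (t (j + 1)) ω - F (t j) ω) ^ 4 - v j)) ^ 2
            + 2 * r ^ 2) ∂P := by
        refine integral_mono_of_nonneg (ae_of_all _ fun ω => sq_nonneg _)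
          ((hI.const_mul 2).add (integrable_const _)) (ae_of_all _ fun ω => ?_)
        have e : ∑ j ∈ Finset.range N, (F (t (j + 1)) ω - F (t j) ω) ^ 4 - 6 / Real.pi * s
            = ∑ j ∈ Finset.range N, ((F (t (j + 1)) ω - F (t j) ω) ^ 4 - v j) + r := by
          rw [Finset.sum_sub_distrib, hr]; ring
        simp only [e]
        nlinarith [sq_nonneg (∑ j ∈ Finset.range N,
          ((F (t (j + 1)) ω - F (t j) ω) ^ 4 - v j) - r)]
    _ = 2 * ∫ ω, (∑ j ∈ Finset.range N, ((F (t (j + 1)) ω - F (t j) ω) ^ 4 - v j)) ^ 2 ∂P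
            + 2 * r ^ 2 := by
        rw [integral_add (hI.const_mul 2) (integrable_const _), integral_const_mul]
        simp
    _ ≤ _ := by linarith

/-- Uniform control of a monotone function against a linear one by its values on a grid. -/
lemma sq_abs_sub_le_of_monotone {V : ℝ → ℝ} (hV : MonotoneOn V (Set.Ici 0)) {c T : ℝ}
    (hc : 0 ≤ c) (hT : 0 < T) {n : ℕ} (hn : 0 < n) {u : ℝ} (hu : u ∈ Set.Icc 0 T) :
    |V u - c * u| ^ 2 ≤
      2 * ∑ i ∈ Finset.range (n + 2), (V (i * (T / n)) - c * (i * (T / n))) ^ 2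
        + 2 * (c * (T / n)) ^ 2 := by
  set h := T / n with hh
  have hn' : (0 : ℝ) < n := by exact_mod_cast hn
  have hpos : 0 < h := by positivity
  set i := ⌊u / h⌋₊ with hi
  have h1 : i * h ≤ u := by
    rw [← le_div_iff₀ hpos]; exact Nat.floor_le (div_nonneg hu.1 hpos.le)
  have h2 : u ≤ (i + 1 : ℕ) * h := by
    rw [← div_le_iff₀ hpos]; push_cast; exact (Nat.lt_floor_add_one _).le
  have hin : i ≤ n := by
    refine Nat.floor_le_of_le ?_
    rw [div_le_iff₀ hpos, hh]
    field_simp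
    exact hu.2
  have hV1 := hV (show (i * h : ℝ) ∈ Set.Ici 0 from Set.mem_Ici.2 (by positivity)) hu.1 h1
  have hV2 := hV hu.1 (show ((i + 1 : ℕ) * h : ℝ) ∈ Set.Ici 0 from
    Set.mem_Ici.2 (by positivity)) h2
  set S := ∑ i ∈ Finset.range (n + 2), (V (i * h) - c * (i * h)) ^ 2 with hS
  have hle : ∀ k ≤ n + 1, |V (k * h) - c * (k * h)| ≤ √S := fun k hk => by
    refine Real.abs_le_sqrt ?_
    exact Finset.single_le_sum (f := fun i : ℕ => (V (i * h) - c * (i * h)) ^ 2)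
      (fun _ _ => sq_nonneg _) (Finset.mem_range.2 (by omega))
  have hSS : √S ^ 2 = S := Real.sq_sqrt (Finset.sum_nonneg fun _ _ => sq_nonneg _)
  have a1 := abs_le.1 (hle i (by omega))
  have a2 := abs_le.1 (hle (i + 1) (by omega))
  have b1 := mul_le_mul_of_nonneg_left h1 hc
  have b2 := mul_le_mul_of_nonneg_left h2 hc
  have e : c * ((i + 1 : ℕ) * h) = c * (i * h) + c * h := by push_cast; ring
  have key : |V u - c * u| ≤ √S + c * h := by
    rw [abs_le]; constructor <;> linarith [a1.1, a2.2]
  calc |V u - c * u| ^ 2 ≤ (√S + c * h) ^ 2 := pow_le_pow_left₀ (abs_nonneg _) key 2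
    _ ≤ _ := by nlinarith [sq_nonneg (√S - c * h)]

lemma finite_setOf_le_of_tendsto_atTop {t : ℕ → ℝ} (h : Tendsto t atTop atTop) (u : ℝ) :
    {j : ℕ | t j ≤ u}.Finite := by
  obtain ⟨M, hM⟩ := (h.eventually_gt_atTop u).exists_forall_of_atTop
  refine (Set.finite_Iio M).subset fun j hj => ?_
  by_contra hc
  exact absurd (hM j (not_lt.1 hc)) (not_lt.2 hj)

end Partition

/-- Theorem 2.3: the quartic variation of `F` is `(6/π)t`, in `L²`, uniformly on
compact time intervals, along any partition of `[0,∞)` of small enough mesh.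
Here `N(u) = max{j : t_j ≤ u}` is written as `sSup {j | t j ≤ u}` and
`V_Π(u) = ∑_{j=1}^{N(u)} |F(t_j) − F(t_{j−1})|⁴`. -/
theorem quartic_variation_of_heat {Ω : Type*} [MeasurableSpace Ω]
    (P : Measure Ω) (F : ℝ → Ω → ℝ) (hF : IsHeatGaussian P F)
    (T : ℝ) (hT : 0 < T) (ε : ℝ) (hε : 0 < ε) :
    ∃ δ > (0 : ℝ), ∀ t : ℕ → ℝ, t 0 = 0 → StrictMono t →
      Tendsto t atTop atTop →
      (∀ j : ℕ, t (j + 1) - t j < δ) →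
      (∫ ω, (⨆ u : Set.Icc (0 : ℝ) T,
          |(∑ j ∈ Finset.range (sSup {j : ℕ | t j ≤ (u : ℝ)}),
              |F (t (j + 1)) ω - F (t j) ω| ^ 4) - 6 / Real.pi * (u : ℝ)| ^ 2) ∂P)
        < ε := by
  obtain ⟨n, hn⟩ := exists_nat_gt (1 + 16 * T ^ 2 / ε)
  have hn1 : (1 : ℝ) < n := lt_of_le_of_lt (by have : 0 ≤ 16 * T ^ 2 / ε := by positivity
                                               linarith) hn
  have hn0 : 0 < n := by exact_mod_cast zero_lt_one.trans hn1
  set C := 2 * ((n : ℝ) + 2) * (720 * (2 * T) + 16) with hC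
  have hCpos : 0 < C := by positivity
  have := hF.1
  refine ⟨min 1 (ε / (2 * C)), by positivity, fun t h0 hmono htend hmesh => ?_⟩
  set δ := min 1 (ε / (2 * C)) with hδ
  have hδ0 : 0 < δ := by positivity
  have hmesh' : ∀ j, t (j + 1) - t j ≤ δ := fun j => (hmesh j).le
  have hp : ∀ k, 0 ≤ t k := fun k => h0 ▸ hmono.monotone (Nat.zero_le k)
  set N : ℝ → ℕ := fun u => sSup {j : ℕ | t j ≤ u} with hN
  have hfin := finite_setOf_le_of_tendsto_atTop htend
  have hne : ∀ u, 0 ≤ u → {j : ℕ | t j ≤ u}.Nonempty := fun u hu => ⟨0, by simpa [h0] using hu⟩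
  have hN1 : ∀ u, 0 ≤ u → t (N u) ≤ u := fun u hu => Nat.sSup_mem (hne u hu) (hfin u).bddAbove
  have hN2 : ∀ u, u ≤ t (N u) + δ := fun u => by
    have h1 : u < t (N u + 1) := by
      by_contra hc
      exact absurd (le_csSup (hfin u).bddAbove (not_lt.1 hc : _ ∈ {j : ℕ | t j ≤ u}))
        (by simp [hN])
    linarith [hmesh (N u)]
  have hN3 : ∀ u v, 0 ≤ u → u ≤ v → N u ≤ N v := fun u v hu huv =>
    csSup_le_csSup (hfin v).bddAbove (hne u hu) fun j hj => le_trans hj huv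
  set V : Ω → ℝ → ℝ := fun ω u =>
    ∑ j ∈ Finset.range (N u), (F (t (j + 1)) ω - F (t j) ω) ^ 4 with hV
  have hVmono : ∀ ω, MonotoneOn (V ω) (Set.Ici 0) := fun ω u hu v _ huv =>
    Finset.sum_le_sum_of_subset_of_nonneg (Finset.range_subset_range.2 (hN3 u v hu huv))
      fun j _ _ => by positivity
  have hc0 : 0 ≤ 6 / Real.pi := by positivity
  have hc : 6 / Real.pi ≤ 2 := by
    rw [div_le_iff₀ Real.pi_pos]; linarith [Real.pi_gt_three]
  have hI : ∀ i : ℕ, Integrable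
      (fun ω => (V ω (i * (T / n)) - 6 / Real.pi * (i * (T / n))) ^ 2) P := fun i => by
    simpa using hF.integrable_sq_quartic_sum_sub hp (N (i * (T / n))) 0 _
  have hB : ∀ i ∈ Finset.range (n + 2),
      ∫ ω, (V ω (i * (T / n)) - 6 / Real.pi * (i * (T / n))) ^ 2 ∂P
        ≤ (720 * (2 * T) + 16) * δ := fun i hi => by
    have hi' : (i : ℝ) ≤ n + 1 := by
      exact_mod_cast Nat.lt_succ_iff.1 (Finset.mem_range.1 hi)
    refine hF.integral_sq_quartic_sum_sub_le h0 hmono.monotone hδ0.le (min_le_left _ _) hmesh'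
      (hN1 _ (by positivity)) (hN2 _) ?_
    calc (i : ℝ) * (T / n) ≤ (2 * n) * (T / n) :=
          mul_le_mul_of_nonneg_right (by linarith) (by positivity)
      _ = 2 * T := by field_simp
  have hmain : (∫ ω, (⨆ u : Set.Icc (0 : ℝ) T,
          |(∑ j ∈ Finset.range (sSup {j : ℕ | t j ≤ (u : ℝ)}),
              |F (t (j + 1)) ω - F (t j) ω| ^ 4) - 6 / Real.pi * (u : ℝ)| ^ 2) ∂P) ≤
      ∫ ω, (2 * ∑ i ∈ Finset.range (n + 2),
        (V ω (i * (T / n)) - 6 / Real.pi * (i * (T / n))) ^ 2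
        + 2 * (6 / Real.pi * (T / n)) ^ 2) ∂P := by
    refine integral_mono_of_nonneg
      (ae_of_all _ fun ω => Real.iSup_nonneg fun u => by positivity)
      (((integrable_finsetSum _ fun i _ => hI i).const_mul 2).add (integrable_const _))
      (ae_of_all _ fun ω => ?_)
    have : Nonempty (Set.Icc (0 : ℝ) T) := ⟨⟨0, le_rfl, hT.le⟩⟩
    refine ciSup_le fun u => ?_
    simp only [(by decide : Even 4).pow_abs]
    exact sq_abs_sub_le_of_monotone (hVmono ω) hc0 hT hn0 u.2
  refine hmain.trans_lt ?_
  rw [integral_add ((integrable_finsetSum _ fun i _ => hI i).const_mul 2) (integrable_const _),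
    integral_const_mul, integral_finsetSum _ fun i _ => hI i]
  have hsum := Finset.sum_le_sum hB
  simp only [Finset.sum_const, Finset.card_range, nsmul_eq_mul] at hsum
  push_cast at hsum
  have hCδ : C * δ ≤ ε / 2 := by
    calc C * δ ≤ C * (ε / (2 * C)) := mul_le_mul_of_nonneg_left (min_le_right _ _) hCpos.le
      _ = ε / 2 := by field_simp
  have hgrid : 2 * (6 / Real.pi * (T / n)) ^ 2 < ε / 2 := by
    have h1 : (6 / Real.pi * (T / n)) ^ 2 ≤ (2 * (T / n)) ^ 2 :=
      pow_le_pow_left₀ (by positivity) (mul_le_mul_of_nonneg_right hc (by positivity)) 2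
    have h2 : 16 * T ^ 2 < ε * n ^ 2 := by
      have h3 : 16 * T ^ 2 / ε < n := by linarith
      rw [div_lt_iff₀ hε] at h3
      nlinarith
    have h4 : (2 * (T / n)) ^ 2 < ε / 4 := by
      rw [mul_pow, div_pow, ← mul_div_assoc, div_lt_iff₀ (by positivity)]
      linarith
    linarith
  simp only [integral_const, probReal_univ, one_smul]
  nlinarith
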